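/- arXiv:2001.08006 — 4 statements merged into one kernel-verified Lean document; each statement's English description precedes it below -/
import Mathlib

section
/- Let A ⊆ ℝ^D be a compact set with reach R(A) > 0. Let 0 < s < R(A), let z ∈ ℝ^D, and set A' = A ∩ B̄(z, s), where B̄(z, s) is the closed Euclidean ball of center z and radius s. If A' is nonempty, then A' has no bottleneck: there is no pair of points p, q ∈ A' with p ≠ q such that ‖p − q‖ = 2·R(A') and the midpoint (p + q)/2 lies in the medial axis Med(A'). -/
/-- The reach of a closed set `A`: the supremum of all `δ ≥ 0` such that every point at
distance `< δ` from `A` has a unique nearest point in `A`. -/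
noncomputable def reach {E : Type*} [NormedAddCommGroup E] (A : Set E) : ℝ :=
  sSup {δ : ℝ | 0 ≤ δ ∧ ∀ y : E, Metric.infDist y A < δ →
    ∃! p : E, p ∈ A ∧ dist y p = Metric.infDist y A}

/-- The medial axis of `A`: points having at least two distinct nearest points in `A`. -/
def medialAxis {E : Type*} [NormedAddCommGroup E] (A : Set E) : Set E :=
  {z : E | ∃ p ∈ A, ∃ q ∈ A, p ≠ q ∧
    dist z p = Metric.infDist z A ∧ dist z q = Metric.infDist z A}

open Metric Filter Topology in
/-- At a point off a compact set with a unique nearest point, the distance function increases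
with slope arbitrarily close to `1` in some direction. -/
theorem exists_infDist_slope_gt {E : Type*} [NormedAddCommGroup E] [InnerProductSpace ℝ E]
    {A : Set E} (hA : IsCompact A) {y : E} (hy : 0 < infDist y A)
    (huniq : ∃! p : E, p ∈ A ∧ dist y p = infDist y A) {k η : ℝ} (hk : k < 1) (hη : 0 < η) :
    ∃ y', y' ≠ y ∧ dist y' y < η ∧ infDist y A + k * dist y' y < infDist y' A := by
  obtain ⟨x, ⟨hxA, hxd⟩, hx⟩ := huniq
  have hne : A.Nonempty := ⟨x, hxA⟩
  set d := infDist y A with hd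
  by_contra! hcon
  have hnx : ‖y - x‖ = d := by rw [← dist_eq_norm, hxd]
  set n : E := (1 / d) • (y - x) with hn
  have hn1 : ‖n‖ = 1 := by
    rw [hn, norm_smul, hnx, Real.norm_of_nonneg (by positivity)]; field_simp
  choose P hPA hPd using fun h : ℝ => hA.exists_infDist_eq_dist hne (y + h • n)
  have hbad : ∀ h, 0 < h → h < η → inner ℝ n (y - P h) ≤ max k 0 * d := by
    intro h h0 h1
    have hdist : dist (y + h • n) y = h := by
      simp [dist_eq_norm, norm_smul, hn1, abs_of_pos h0]
    have hle := hcon (y + h • n) (by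
      intro he
      rw [he, dist_self] at hdist
      exact h0.ne hdist) (by rw [hdist]; exact h1)
    rw [hdist, hPd h] at hle
    have hyP : d ≤ ‖y - P h‖ := by
      rw [← dist_eq_norm]; exact infDist_le_dist_of_mem (hPA h)
    have hexp : dist (y + h • n) (P h) ^ 2
        = ‖y - P h‖ ^ 2 + 2 * h * inner ℝ n (y - P h) + h ^ 2 := by
      rw [dist_eq_norm, show y + h • n - P h = (y - P h) + h • n by abel, norm_add_sq_real,
        norm_smul, hn1, inner_smul_right, real_inner_comm, Real.norm_of_nonneg h0.le]
      ring
    have hk0 : k ≤ max k 0 := le_max_left _ _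
    have hk00 : 0 ≤ max k 0 := le_max_right _ _
    have hk1 : max k 0 < 1 := max_lt hk one_pos
    have hle' : dist (y + h • n) (P h) ≤ d + max k 0 * h := by nlinarith
    have hsq : dist (y + h • n) (P h) ^ 2 ≤ (d + max k 0 * h) ^ 2 := by gcongr
    have hyP2 : d ^ 2 ≤ ‖y - P h‖ ^ 2 := by gcongr
    have hkk : (max k 0) ^ 2 ≤ 1 := by nlinarith
    have : h * inner ℝ n (y - P h) ≤ h * (max k 0 * d) := by nlinarith [sq_nonneg h]
    exact le_of_mul_le_mul_left this h0
  have hu0 : Tendsto (fun i : ℕ => 1 / ((i : ℝ) + 1)) atTop (𝓝 0) :=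
    tendsto_one_div_add_atTop_nhds_zero_nat
  obtain ⟨w, hwA, φ, hφ, hlim⟩ := hA.tendsto_subseq (x := fun i : ℕ => P (1 / ((i : ℝ) + 1)))
    (fun i => hPA _)
  have hu := hu0.comp hφ.tendsto_atTop
  have hyu : Tendsto (fun i => y + ((fun i : ℕ => 1 / ((i : ℝ) + 1)) ∘ φ) i • n) atTop (𝓝 y) := by
    simpa using tendsto_const_nhds.add (hu.smul_const n)
  have hwd : dist y w = d := by
    have h1 := (continuous_infDist_pt A).continuousAt.tendsto.comp hyu
    have h2 := hyu.dist hlim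
    refine tendsto_nhds_unique h2 (h1.congr fun i => ?_)
    exact hPd _
  have hwx : w = x := hx w ⟨hwA, hwd⟩
  have hl : Tendsto (fun i => inner ℝ n (y - P (((fun i : ℕ => 1 / ((i : ℝ) + 1)) ∘ φ) i))) atTop
      (𝓝 (inner ℝ n (y - w))) := tendsto_const_nhds.inner (tendsto_const_nhds.sub hlim)
  have hfin : inner ℝ n (y - w) ≤ max k 0 * d := by
    refine le_of_tendsto hl ?_
    filter_upwards [hu.eventually (gt_mem_nhds hη)] with i hi
    exact hbad _ (by simp only [Function.comp]; positivity) hi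
  have : inner ℝ n (y - w) = d := by
    rw [hwx, hn, inner_smul_left, real_inner_self_eq_norm_sq, hnx]
    simp; field_simp
  have hk1 : max k 0 < 1 := max_lt hk one_pos
  nlinarith

open Metric in
/-- If points at distance less than `r` from a compact set have unique nearest points, then from a
point off the set one can move away from the set at unit speed up to distance `ρ < r`. -/
theorem exists_infDist_ge_of_unique_nearest {E : Type*} [NormedAddCommGroup E]
    [InnerProductSpace ℝ E] [ProperSpace E] {A : Set E} (hA : IsCompact A) {r ρ : ℝ} (hρ : ρ < r)
    (hr : ∀ y : E, infDist y A < r → ∃! p : E, p ∈ A ∧ dist y p = infDist y A)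
    {m : E} (hm : 0 < infDist m A) (hmρ : infDist m A ≤ ρ) :
    ∃ c, dist c m ≤ ρ - infDist m A ∧ ρ ≤ infDist c A := by
  set d := infDist m A with hd
  have hcomp : IsCompact (closedBall m (ρ - d)) := isCompact_closedBall _ _
  have hmem : m ∈ closedBall m (ρ - d) := mem_closedBall_self (by linarith)
  obtain ⟨c, hc, hmax⟩ := hcomp.exists_isMaxOn ⟨m, hmem⟩ (continuous_infDist_pt A).continuousOn
  refine ⟨c, hc, ?_⟩
  have key : ∀ k : ℝ, 0 ≤ k → k < 1 → d + k * (ρ - d) ≤ infDist c A := by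
    intro k hk0 hk1
    obtain ⟨y, hy, hymax⟩ := hcomp.exists_isMaxOn (f := fun y => infDist y A - k * dist y m)
      ⟨m, hmem⟩ (by fun_prop)
    have h0 : d ≤ infDist y A - k * dist y m := by simpa using hymax hmem
    have hym : dist y m ≤ ρ - d := hy
    have hdy : infDist y A ≤ d + dist y m := infDist_le_infDist_add_dist
    have hyc : infDist y A ≤ infDist c A := hmax hy
    have hkd : 0 ≤ k * dist y m := by positivity
    rcases hym.lt_or_eq with hlt | heq
    · obtain ⟨y', -, hy'1, hy'2⟩ := exists_infDist_slope_gt hA (y := y) (by linarith)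
        (hr y (by linarith)) hk1 (sub_pos.2 hlt)
      have htri := dist_triangle y' y m
      have h3 : infDist y' A - k * dist y' m ≤ infDist y A - k * dist y m :=
        hymax (show dist y' m ≤ ρ - d by linarith)
      nlinarith
    · rw [heq] at h0
      linarith
  by_contra! hlt
  have hcd : d ≤ infDist c A := hmax hmem
  have hpos : 0 < ρ - d := by linarith
  have h1 := key ((infDist c A - d + (ρ - d)) / (2 * (ρ - d)))
    (div_nonneg (by linarith) (by linarith)) (by rw [div_lt_one (by linarith)]; linarith)
  have h2 : (infDist c A - d + (ρ - d)) / (2 * (ρ - d)) * (ρ - d)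
      = (infDist c A - d + (ρ - d)) / 2 := by field_simp
  linarith

/-- Apollonius' identity in terms of distances. -/
theorem dist_sq_add_dist_sq_eq_midpoint {E : Type*} [NormedAddCommGroup E]
    [InnerProductSpace ℝ E] (c p q : E) :
    dist c p ^ 2 + dist c q ^ 2 = 2 * dist c (midpoint ℝ p q) ^ 2 + 2 * (dist p q / 2) ^ 2 := by
  have h := parallelogram_law_with_norm ℝ (c - p) (c - q)
  have h1 : c - p + (c - q) = (2 : ℝ) • (c - midpoint ℝ p q) := by
    rw [midpoint_eq_smul_add, smul_sub, smul_smul, two_smul]; norm_num; abel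
  have h2 : c - p - (c - q) = q - p := by abel
  rw [h1, h2, norm_smul, norm_sub_rev q p, Real.norm_ofNat] at h
  simp only [dist_eq_norm]
  linarith

open Metric in
/-- In a compact set whose points at distance less than `r` have unique nearest points, midpoints
of chords of half-length less than `ρ < r` are as close to the set as for a sphere of
radius `ρ`. -/
theorem infDist_midpoint_of_unique_nearest {E : Type*} [NormedAddCommGroup E]
    [InnerProductSpace ℝ E] [ProperSpace E] {A : Set E} (hA : IsCompact A) {r ρ : ℝ} (hρ : ρ < r)
    (hr : ∀ y : E, infDist y A < r → ∃! p : E, p ∈ A ∧ dist y p = infDist y A)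
    {p q : E} (hp : p ∈ A) (hq : q ∈ A) (hpq : dist p q / 2 < ρ) :
    infDist (midpoint ℝ p q) A < ρ ∧ 2 * ρ * infDist (midpoint ℝ p q) A
      ≤ infDist (midpoint ℝ p q) A ^ 2 + (dist p q / 2) ^ 2 := by
  have hlt : infDist (midpoint ℝ p q) A < ρ := by
    refine (infDist_le_dist_of_mem hp).trans_lt (lt_of_eq_of_lt ?_ hpq)
    rw [dist_midpoint_left, Real.norm_ofNat]; ring
  refine ⟨hlt, ?_⟩
  have hρ0 : 0 ≤ ρ := infDist_nonneg.trans hlt.le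
  rcases (infDist_nonneg (x := midpoint ℝ p q) (s := A)).eq_or_lt with h0 | h0
  · rw [← h0]; nlinarith [sq_nonneg (dist p q / 2)]
  obtain ⟨c, hc1, hc2⟩ := exists_infDist_ge_of_unique_nearest hA hρ hr h0 hlt.le
  have hcp : ρ ^ 2 ≤ dist c p ^ 2 := by gcongr; exact hc2.trans (infDist_le_dist_of_mem hp)
  have hcq : ρ ^ 2 ≤ dist c q ^ 2 := by gcongr; exact hc2.trans (infDist_le_dist_of_mem hq)
  have hcm : dist c (midpoint ℝ p q) ^ 2 ≤ (ρ - infDist (midpoint ℝ p q) A) ^ 2 := by gcongr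
  nlinarith [dist_sq_add_dist_sq_eq_midpoint c p q]

/-- The sagitta of a chord of half-length `h` decreases strictly with the radius. -/
theorem sagitta_add_lt {a d h S ρ : ℝ} (hS : 0 ≤ S) (hh : 0 < h) (hah : a ^ 2 + h ^ 2 ≤ S ^ 2)
    (hSρ : S < ρ) (hdρ : d < ρ) (hd : 2 * ρ * d ≤ d ^ 2 + h ^ 2) : d + a < S := by
  by_contra! hcon
  have haS : a < S := by nlinarith
  nlinarith [mul_pos (sub_pos.2 hSρ) (sub_pos.2 haS),
    mul_nonneg (sub_nonneg.2 hcon) (by linarith : 0 ≤ 2 * ρ - d - (S - a))]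

open Metric in
/-- Intersecting a compact set with a ball of radius `s < ρ < r` preserves uniqueness of nearest
points at distance less than `ρ`. -/
theorem existsUnique_nearest_inter_closedBall {E : Type*} [NormedAddCommGroup E]
    [InnerProductSpace ℝ E] [ProperSpace E] {A : Set E} (hA : IsCompact A) {r ρ s : ℝ}
    (hρ : ρ < r) (hr : ∀ y : E, infDist y A < r → ∃! p : E, p ∈ A ∧ dist y p = infDist y A)
    (hs0 : 0 ≤ s) (hs : s < ρ) {z : E} (hne : (A ∩ closedBall z s).Nonempty) {y : E}
    (hy : infDist y (A ∩ closedBall z s) < ρ) :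
    ∃! p : E, p ∈ A ∩ closedBall z s ∧ dist y p = infDist y (A ∩ closedBall z s) := by
  obtain ⟨p, hp, hpd⟩ := (hA.inter_right isClosed_closedBall).exists_infDist_eq_dist hne y
  refine ⟨p, ⟨hp, hpd.symm⟩, ?_⟩
  rintro q ⟨hq, hqd⟩
  by_contra hqp
  have hh : 0 < dist p q / 2 := half_pos (dist_pos.2 (Ne.symm hqp))
  have hzp : dist z p ^ 2 ≤ s ^ 2 := by
    gcongr; rw [dist_comm]; exact hp.2
  have hzq : dist z q ^ 2 ≤ s ^ 2 := by
    gcongr; rw [dist_comm]; exact hq.2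
  have hzm := dist_sq_add_dist_sq_eq_midpoint z p q
  have hym := dist_sq_add_dist_sq_eq_midpoint y p q
  rw [hqd, ← hpd] at hym
  have hpqρ : dist p q / 2 < ρ := by nlinarith [sq_nonneg (dist z (midpoint ℝ p q))]
  obtain ⟨h1, h2⟩ := infDist_midpoint_of_unique_nearest hA hρ hr hp.1 hq.1 hpqρ
  obtain ⟨x, hxA, hxd⟩ := hA.exists_infDist_eq_dist ⟨p, hp.1⟩ (midpoint ℝ p q)
  have hxz := sagitta_add_lt (a := dist z (midpoint ℝ p q)) hs0 hh (by linarith) hs h1 h2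
  have hxy := sagitta_add_lt (a := dist y (midpoint ℝ p q)) infDist_nonneg hh (by linarith)
    hy h1 h2
  have hx : x ∈ A ∩ closedBall z s := by
    refine ⟨hxA, ?_⟩
    rw [mem_closedBall']
    linarith [dist_triangle z (midpoint ℝ p q) x]
  linarith [dist_triangle y (midpoint ℝ p q) x, infDist_le_dist_of_mem (x := y) hx]

/-- If `A ⊆ ℝ^D` is compact with positive reach, `0 < s < reach A`,
and `A' = A ∩ B̄(z, s)` is nonempty, then `A'` has no bottleneck: there is no pair
`p ≠ q` in `A'` with `‖p - q‖ = 2 · reach A'` whose midpoint lies in the medial axis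
of `A'`. -/
theorem no_bottleneck_in_ball_intersection {D : ℕ}
    (A : Set (EuclideanSpace ℝ (Fin D))) (hA : IsCompact A) (hreach : 0 < reach A)
    (s : ℝ) (hs0 : 0 < s) (hs : s < reach A) (z : EuclideanSpace ℝ (Fin D))
    (A' : Set (EuclideanSpace ℝ (Fin D))) (hA' : A' = A ∩ Metric.closedBall z s)
    (hne : A'.Nonempty) :
    ¬ ∃ p ∈ A', ∃ q ∈ A', p ≠ q ∧ ‖p - q‖ = 2 * reach A' ∧
      midpoint ℝ p q ∈ medialAxis A' := by
  rintro ⟨p, hp, q, hq, hpq, hnorm, -⟩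
  subst hA'
  rw [reach] at hs
  obtain ⟨r, ⟨-, hr⟩, hsr⟩ := exists_lt_of_lt_csSup (by
    exact ⟨0, le_rfl, fun y hy => absurd hy Metric.infDist_nonneg.not_gt⟩) hs
  by_cases hb : BddAbove {δ : ℝ | 0 ≤ δ ∧
      ∀ y : EuclideanSpace ℝ (Fin D), Metric.infDist y (A ∩ Metric.closedBall z s) < δ →
        ∃! p, p ∈ A ∩ Metric.closedBall z s ∧
          dist y p = Metric.infDist y (A ∩ Metric.closedBall z s)}
  · have hle : (s + r) / 2 ≤ reach (A ∩ Metric.closedBall z s) :=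
      le_csSup hb ⟨by linarith, fun y hy =>
        existsUnique_nearest_inter_closedBall hA (by linarith) hr hs0.le (by linarith) hne hy⟩
    have hp' : dist p z ≤ s := hp.2
    have hq' : dist q z ≤ s := hq.2
    linarith [dist_triangle_right p q z, dist_eq_norm p q]
  · rw [reach, Real.sSup_of_not_bddAbove hb, mul_zero, norm_sub_eq_zero_iff] at hnorm
    exact hpq hnorm
end

section
/- Let X ⊆ ℝ^D be a nonempty compact set and let r₁, r₂, t > 0 satisfy r₁ ≥ 2t and r₂ ≥ t + r₁. Then h_X(t) = sup_{p ∈ X} h^loc_X(p, r₁, r₂; t). -/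
/-- The radius of a smallest enclosing closed ball of `σ`. -/
noncomputable def rad {E : Type*} [NormedAddCommGroup E] (σ : Set E) : ℝ :=
  sInf {r : ℝ | 0 ≤ r ∧ ∃ c : E, σ ⊆ Metric.closedBall c r}

/-- Asymmetric Hausdorff distance `H(A | B) = sup_{a ∈ A} dist (a, B)`. -/
noncomputable def asymmHaus {E : Type*} [NormedAddCommGroup E] (A B : Set E) : ℝ :=
  sSup ((fun a => Metric.infDist a B) '' A)

/-- The convex hull of `X` at scale `t`. -/
def scaleHull {E : Type*} [NormedAddCommGroup E] [NormedSpace ℝ E]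
    (X : Set E) (t : ℝ) : Set E :=
  ⋃ (σ : Set E) (_ : σ ⊆ X ∧ rad σ ≤ t), convexHull ℝ σ

/-- The convexity defect function `h_X(t)`. -/
noncomputable def cdf {E : Type*} [NormedAddCommGroup E] [NormedSpace ℝ E]
    (X : Set E) (t : ℝ) : ℝ :=
  asymmHaus (scaleHull X t) X

/-- The local convexity defect function `h^loc_X(p, r₁, r₂; t)`. -/
noncomputable def cdfLoc {E : Type*} [NormedAddCommGroup E] [NormedSpace ℝ E]
    (X : Set E) (p : E) (r₁ r₂ t : ℝ) : ℝ :=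
  asymmHaus
    (⋃ (σ : Set E) (_ : σ ⊆ X ∩ Metric.closedBall p r₁ ∧ rad σ ≤ t), convexHull ℝ σ)
    (X ∩ Metric.closedBall p r₂)

theorem exists_subset_closedBall_of_rad_lt {E : Type*} [NormedAddCommGroup E] {σ : Set E}
    (hσ : Bornology.IsBounded σ) {r : ℝ} (h : rad σ < r) :
    ∃ c : E, σ ⊆ Metric.closedBall c r := by
  have hne : {r : ℝ | 0 ≤ r ∧ ∃ c : E, σ ⊆ Metric.closedBall c r}.Nonempty := by
    obtain ⟨s, hs, hsub⟩ := hσ.subset_closedBall_lt 0 0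
    exact ⟨s, hs.le, 0, hsub⟩
  obtain ⟨s, ⟨-, c, hc⟩, hs⟩ := exists_lt_of_csInf_lt hne h
  exact ⟨c, hc.trans (Metric.closedBall_subset_closedBall hs.le)⟩

theorem dist_le_two_mul_of_rad_le {E : Type*} [NormedAddCommGroup E] {σ : Set E}
    (hσ : Bornology.IsBounded σ) {t : ℝ} (h : rad σ ≤ t) {x y : E} (hx : x ∈ σ) (hy : y ∈ σ) :
    dist x y ≤ 2 * t := by
  refine le_of_forall_pos_le_add fun ε hε => ?_
  obtain ⟨c, hc⟩ := exists_subset_closedBall_of_rad_lt hσ (r := t + ε / 2) (by linarith)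
  have hxc := Metric.mem_closedBall.1 (hc hx)
  have hyc := Metric.mem_closedBall.1 (hc hy)
  linarith [dist_triangle_right x y c]

/-- A point in the convex hull of a set is at least as close to some point of the set as
that point is to a prescribed centre. -/
theorem exists_dist_le_dist_of_mem_convexHull {E : Type*} [NormedAddCommGroup E]
    [InnerProductSpace ℝ E] {σ : Set E} {a : E} (ha : a ∈ convexHull ℝ σ) (c : E) :
    ∃ x ∈ σ, dist a x ≤ dist x c := by
  obtain ⟨x, hx, hax⟩ := ((innerₛₗ ℝ (a - c)).convexOn
    (convex_convexHull ℝ σ)).exists_ge_of_mem_convexHull (subset_convexHull ℝ σ) ha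
  refine ⟨x, hx, ?_⟩
  have hinner : 0 ≤ inner ℝ (x - a) (a - c) := by
    rw [real_inner_comm, inner_sub_right]
    simpa only [innerₛₗ_apply_apply, sub_nonneg] using hax
  have hsq := norm_add_sq_real (x - a) (a - c)
  rw [sub_add_sub_cancel] at hsq
  rw [dist_comm, dist_eq_norm, dist_eq_norm]
  refine le_of_sq_le_sq ?_ (norm_nonneg _)
  nlinarith [sq_nonneg ‖a - c‖]

theorem infDist_le_of_mem_convexHull {E : Type*} [NormedAddCommGroup E]
    [InnerProductSpace ℝ E] {X σ : Set E} (hX : Bornology.IsBounded X) (hσ : σ ⊆ X)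
    {t : ℝ} (h : rad σ ≤ t) {a : E} (ha : a ∈ convexHull ℝ σ) :
    Metric.infDist a X ≤ t := by
  refine le_of_forall_pos_le_add fun ε hε => ?_
  obtain ⟨c, hc⟩ := exists_subset_closedBall_of_rad_lt (hX.subset hσ) (r := t + ε) (by linarith)
  obtain ⟨x, hx, hax⟩ := exists_dist_le_dist_of_mem_convexHull ha c
  exact (Metric.infDist_le_dist_of_mem (hσ hx)).trans (hax.trans (hc hx))

theorem infDist_inter_closedBall_eq {E : Type*} [PseudoMetricSpace E] {X : Set E}
    (hX : IsCompact X) (hne : X.Nonempty) {a p : E} {r s t : ℝ}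
    (hat : Metric.infDist a X ≤ t) (hap : dist a p ≤ r) (hs : t + r ≤ s) :
    Metric.infDist a (X ∩ Metric.closedBall p s) = Metric.infDist a X := by
  obtain ⟨q, hq, hqa⟩ := hX.exists_infDist_eq_dist hne a
  have hmem : q ∈ X ∩ Metric.closedBall p s := by
    refine ⟨hq, Metric.mem_closedBall.2 ?_⟩
    linarith [dist_triangle_left q p a]
  refine le_antisymm ?_ (Metric.infDist_le_infDist_of_subset Set.inter_subset_left ⟨q, hmem⟩)
  exact hqa ▸ Metric.infDist_le_dist_of_mem hmem

/-- For `p ∈ X`, the local defect is the asymmetric distance from the local hull to all of `X`. -/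
theorem cdfLoc_eq_asymmHaus {E : Type*} [NormedAddCommGroup E] [InnerProductSpace ℝ E]
    {X : Set E} (hX : IsCompact X) (hne : X.Nonempty) (p : E) {r₁ r₂ t : ℝ}
    (h : t + r₁ ≤ r₂) :
    cdfLoc X p r₁ r₂ t = asymmHaus (scaleHull (X ∩ Metric.closedBall p r₁) t) X := by
  unfold cdfLoc asymmHaus scaleHull
  congr 1
  refine Set.image_congr fun a ha => ?_
  simp only [Set.mem_iUnion] at ha
  obtain ⟨σ, ⟨hσ, hrad⟩, haσ⟩ := ha
  refine infDist_inter_closedBall_eq hX hne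
    (infDist_le_of_mem_convexHull hX.isBounded (hσ.trans Set.inter_subset_left) hrad haσ) ?_ h
  exact convexHull_min (hσ.trans Set.inter_subset_right) (convex_closedBall p r₁) haσ

theorem scaleHull_mono {E : Type*} [NormedAddCommGroup E] [NormedSpace ℝ E] {X Y : Set E}
    (h : X ⊆ Y) (t : ℝ) : scaleHull X t ⊆ scaleHull Y t :=
  Set.iUnion_mono fun _ => Set.iUnion_mono' fun hσ => ⟨⟨hσ.1.trans h, hσ.2⟩, subset_rfl⟩

theorem infDist_le_of_mem_scaleHull {E : Type*} [NormedAddCommGroup E]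
    [InnerProductSpace ℝ E] {X : Set E} (hX : Bornology.IsBounded X) {t : ℝ} {a : E}
    (ha : a ∈ scaleHull X t) : Metric.infDist a X ≤ t := by
  simp only [scaleHull, Set.mem_iUnion] at ha
  obtain ⟨σ, ⟨hσ, hrad⟩, haσ⟩ := ha
  exact infDist_le_of_mem_convexHull hX hσ hrad haσ

theorem infDist_le_asymmHaus_scaleHull {E : Type*} [NormedAddCommGroup E]
    [InnerProductSpace ℝ E] {X Y : Set E} (hX : Bornology.IsBounded X) (hY : Y ⊆ X) {t : ℝ}
    {a : E} (ha : a ∈ scaleHull Y t) :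
    Metric.infDist a X ≤ asymmHaus (scaleHull Y t) X := by
  refine le_csSup ⟨t, ?_⟩ (Set.mem_image_of_mem _ ha)
  rintro _ ⟨b, hb, rfl⟩
  exact infDist_le_of_mem_scaleHull hX (scaleHull_mono hY t hb)

theorem asymmHaus_nonneg {E : Type*} [NormedAddCommGroup E] (A B : Set E) :
    0 ≤ asymmHaus A B := by
  refine Real.sSup_nonneg ?_
  rintro _ ⟨a, -, rfl⟩
  exact Metric.infDist_nonneg

theorem asymmHaus_scaleHull_le {E : Type*} [NormedAddCommGroup E]
    [InnerProductSpace ℝ E] {X Y : Set E} (hX : Bornology.IsBounded X) (hY : Y ⊆ X) (t : ℝ) :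
    asymmHaus (scaleHull Y t) X ≤ cdf X t := by
  refine Real.sSup_le ?_ (asymmHaus_nonneg _ _)
  rintro _ ⟨a, ha, rfl⟩
  exact infDist_le_asymmHaus_scaleHull hX subset_rfl (scaleHull_mono hY t ha)

/-- Every point of the hull at scale `t` lies in a local hull of radius at least `2 * t`. -/
theorem exists_mem_scaleHull_inter_closedBall {E : Type*} [NormedAddCommGroup E]
    [NormedSpace ℝ E] {X : Set E} (hX : Bornology.IsBounded X) {r t : ℝ} (h : 2 * t ≤ r)
    {a : E} (ha : a ∈ scaleHull X t) :
    ∃ p ∈ X, a ∈ scaleHull (X ∩ Metric.closedBall p r) t := by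
  simp only [scaleHull, Set.mem_iUnion] at ha ⊢
  obtain ⟨σ, ⟨hσ, hrad⟩, haσ⟩ := ha
  obtain ⟨p, hp⟩ := convexHull_nonempty_iff.1 ⟨a, haσ⟩
  refine ⟨p, hσ hp, σ, ⟨fun x hx => ⟨hσ hx, ?_⟩, hrad⟩, haσ⟩
  exact (dist_le_two_mul_of_rad_le (hX.subset hσ) hrad hx hp).trans h

/-- For a nonempty compact `X ⊆ ℝ^D` and `r₁, r₂, t > 0` with `r₁ ≥ 2t` and
`r₂ ≥ t + r₁`, the convexity defect function equals the supremum over `p ∈ X` of the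
local convexity defects. -/
theorem cdf_eq_sup_cdfLoc {D : ℕ} (X : Set (EuclideanSpace ℝ (Fin D)))
    (hX : IsCompact X) (hne : X.Nonempty)
    (r₁ r₂ t : ℝ) (hr₁ : 0 < r₁) (hr₂ : 0 < r₂) (ht : 0 < t)
    (h₁ : 2 * t ≤ r₁) (h₂ : t + r₁ ≤ r₂) :
    cdf X t = sSup ((fun p => cdfLoc X p r₁ r₂ t) '' X) := by
  have hb := hX.isBounded
  simp only [cdfLoc_eq_asymmHaus hX hne _ h₂]
  have hle : ∀ y ∈ (fun p => asymmHaus (scaleHull (X ∩ Metric.closedBall p r₁) t) X) '' X,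
      y ≤ cdf X t := by
    rintro _ ⟨p, -, rfl⟩
    exact asymmHaus_scaleHull_le hb Set.inter_subset_left t
  refine le_antisymm (Real.sSup_le ?_ (Real.sSup_nonneg ?_)) (csSup_le (hne.image _) hle)
  · rintro _ ⟨a, ha, rfl⟩
    obtain ⟨p, hp, hap⟩ := exists_mem_scaleHull_inter_closedBall hb h₁ ha
    exact (infDist_le_asymmHaus_scaleHull hb Set.inter_subset_left hap).trans
      (le_csSup ⟨cdf X t, hle⟩ (Set.mem_image_of_mem _ hp))
  · rintro _ ⟨p, -, rfl⟩
    exact asymmHaus_nonneg _ _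
end

section
/- Let S : ℝ^d × ℝ^d → ℝ^{D−d} be a continuous bilinear map and T : ℝ^d × ℝ^d × ℝ^d → ℝ^{D−d} a continuous trilinear map, with diagonal norms ‖S‖ = sup_{‖v‖ ≤ 1} ‖S(v, v)‖ and ‖T‖ = sup_{‖v‖ ≤ 1} ‖T(v, v, v)‖. Let X = M(S, T) = {(v, S(v,v) + T(v,v,v)) : v ∈ ℝ^d} ⊆ ℝ^d × ℝ^{D−d} = ℝ^D. Let 0 < r₁ ≤ r₂ satisfy r₂² ‖T‖ ≤ √13 / 4 (equivalently r₂ ≤ (13^{1/4}/2)‖T‖^{−1/2}). Then for every t > 0 with t‖S‖ ≤ 1/2 and t ≤ (2/√13) r₁, we have h^loc_X(0, r₁, r₂; t) ≥ (t − (1/2) t⁵ ‖T‖²)² ‖S‖ ≥ t² ‖S‖ − t⁶ ‖S‖ ‖T‖². -/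
theorem rad_le {E : Type*} [NormedAddCommGroup E] {σ : Set E} {c : E} {r : ℝ} (hr : 0 ≤ r)
    (h : σ ⊆ Metric.closedBall c r) :
    rad σ ≤ r :=
  csInf_le ⟨0, fun _ hs => hs.1⟩ ⟨hr, c, h⟩

section

variable {E F : Type*} [NormedAddCommGroup E] [NormedSpace ℝ E]
  [NormedAddCommGroup F] [NormedSpace ℝ F]

/-- A continuous positively homogeneous function is bounded by its supremum over the unit ball. -/
theorem norm_le_sSup_unitBall_mul_pow [ProperSpace E] {f : E → F} (hf : Continuous f) {k : ℕ}
    (hhom : ∀ (c : ℝ) (v : E), f (c • v) = c ^ k • f v) (h_zero : f 0 = 0) (w : E) :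
    ‖f w‖ ≤ sSup ((fun v => ‖f v‖) '' Metric.closedBall (0 : E) 1) * ‖w‖ ^ k := by
  rcases eq_or_ne w 0 with rfl | hw
  · rw [h_zero, norm_zero]
    exact mul_nonneg (Real.sSup_nonneg (by rintro _ ⟨v, -, rfl⟩; exact norm_nonneg _))
      (pow_nonneg (norm_nonneg _) _)
  have hw' : 0 < ‖w‖ := norm_pos_iff.2 hw
  have hbdd : BddAbove ((fun v => ‖f v‖) '' Metric.closedBall (0 : E) 1) :=
    ((isCompact_closedBall 0 1).image hf.norm).bddAbove
  have hunit : ‖f (‖w‖⁻¹ • w)‖ ≤ sSup ((fun v => ‖f v‖) '' Metric.closedBall (0 : E) 1) := by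
    refine le_csSup hbdd ⟨_, ?_, rfl⟩
    rw [mem_closedBall_zero_iff, norm_smul, norm_inv, norm_norm, inv_mul_cancel₀ hw'.ne']
  calc ‖f w‖ = ‖f (‖w‖⁻¹ • w)‖ * ‖w‖ ^ k := by
        rw [hhom, norm_smul, norm_pow, norm_inv, norm_norm]
        rw [mul_right_comm, ← mul_pow, inv_mul_cancel₀ hw'.ne', one_pow, one_mul]
    _ ≤ _ := by gcongr

/-- A lower bound for the local convexity defect given by the midpoint of two points. -/
theorem le_cdfLoc_of_pair {X : Set E} {p x y : E} {r₁ r₂ t b : ℝ} (hr₁₂ : r₁ ≤ r₂) (ht : 0 ≤ t)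
    (hx : x ∈ X ∩ Metric.closedBall p r₁) (hy : y ∈ X ∩ Metric.closedBall p r₁)
    (hxt : dist x (midpoint ℝ x y) ≤ t)
    (hb : ∀ z ∈ X ∩ Metric.closedBall p r₂, b ≤ dist (midpoint ℝ x y) z) :
    b ≤ cdfLoc X p r₁ r₂ t := by
  have hx₂ : x ∈ X ∩ Metric.closedBall p r₂ := ⟨hx.1, Metric.closedBall_subset_closedBall hr₁₂ hx.2⟩
  refine ((Metric.le_infDist ⟨x, hx₂⟩).2 fun {z} hz => hb z hz).trans
    (le_csSup ?_ ⟨midpoint ℝ x y, ?_, rfl⟩)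
  · refine ⟨r₁ + dist p x, ?_⟩
    rintro _ ⟨a, ha, rfl⟩
    simp only [Set.mem_iUnion] at ha
    obtain ⟨σ, ⟨hσ, -⟩, ha⟩ := ha
    have har : a ∈ Metric.closedBall p r₁ :=
      convexHull_min (hσ.trans Set.inter_subset_right) (convex_closedBall p r₁) ha
    calc Metric.infDist a (X ∩ Metric.closedBall p r₂) ≤ dist a x := Metric.infDist_le_dist_of_mem hx₂
      _ ≤ dist a p + dist p x := dist_triangle _ _ _
      _ ≤ _ := by gcongr; exact har
  · simp only [Set.mem_iUnion]
    refine ⟨{x, y}, ⟨Set.insert_subset hx (Set.singleton_subset_iff.2 hy),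
      rad_le (c := midpoint ℝ x y) ht ?_⟩, ?_⟩
    · refine Set.insert_subset hxt (Set.singleton_subset_iff.2 ?_)
      rw [Metric.mem_closedBall]
      refine le_trans (le_of_eq ?_) hxt
      rw [dist_right_midpoint, dist_left_midpoint]
    · rw [convexHull_pair]
      exact midpoint_mem_segment x y

end

/-- The half-chord parameter `τ = t - t⁵n²/2` keeps the chord within radius `t`. -/
theorem half_chord_bounds {t n : ℝ} (ht : 0 < t) (h : t ^ 4 * n ^ 2 ≤ 1 / 13) :
    0 ≤ t - 1 / 2 * t ^ 5 * n ^ 2 ∧ t - 1 / 2 * t ^ 5 * n ^ 2 ≤ t ∧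
      (t - 1 / 2 * t ^ 5 * n ^ 2) ^ 2 + (t - 1 / 2 * t ^ 5 * n ^ 2) ^ 6 * n ^ 2 ≤ t ^ 2 := by
  obtain ⟨a, ha⟩ : ∃ a, a = t ^ 4 * n ^ 2 := ⟨_, rfl⟩
  have ha0 : 0 ≤ a := by rw [ha]; positivity
  have ha1 : a ≤ 1 / 13 := ha ▸ h
  have hτ : t - 1 / 2 * t ^ 5 * n ^ 2 = t * (1 - a / 2) := by rw [ha]; ring
  have hq : (1 - a / 2) ^ 6 ≤ 1 - a / 2 :=
    pow_le_of_le_one (by linarith) (by linarith) (by norm_num)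
  refine ⟨by rw [hτ]; exact mul_nonneg ht.le (by linarith), by rw [hτ]; nlinarith, ?_⟩
  calc (t - 1 / 2 * t ^ 5 * n ^ 2) ^ 2 + (t - 1 / 2 * t ^ 5 * n ^ 2) ^ 6 * n ^ 2
      = t ^ 2 * ((1 - a / 2) ^ 2 + a * (1 - a / 2) ^ 6) := by rw [hτ, ha]; ring
    _ ≤ t ^ 2 * 1 := by
        gcongr
        nlinarith [mul_le_mul_of_nonneg_left hq ha0]
    _ = t ^ 2 := mul_one _

/-- The chord endpoints stay within the ball of radius `r`. -/
theorem sq_add_sq_le_of_scale {τ t s n r : ℝ} (hτ : 0 ≤ τ) (hτt : τ ≤ t) (hs : 0 ≤ s) (hn : 0 ≤ n)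
    (hts : t * s ≤ 1 / 2) (htn : t ^ 4 * n ^ 2 ≤ 1 / 13) (htr : 13 * t ^ 2 ≤ 4 * r ^ 2) :
    τ ^ 2 + (τ ^ 2 * s + τ ^ 3 * n) ^ 2 ≤ r ^ 2 := by
  have ht : 0 ≤ t := hτ.trans hτt
  have h2 : t ^ 2 * n ≤ 1 / 2 := by
    refine le_of_sq_le_sq ?_ (by norm_num)
    nlinarith
  calc τ ^ 2 + (τ ^ 2 * s + τ ^ 3 * n) ^ 2 ≤ t ^ 2 + (t ^ 2 * s + t ^ 3 * n) ^ 2 := by gcongr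
    _ = t ^ 2 * (1 + (t * s + t ^ 2 * n) ^ 2) := by ring
    _ ≤ t ^ 2 * (1 + (1 / 2 + 1 / 2) ^ 2) := by gcongr
    _ ≤ r ^ 2 := by nlinarith

/-- A point at height at most `ρ²s + ρ³n` over a base point at distance `ρ` is at least `A` away
from the point at height `A` over the origin. -/
theorem sq_le_sq_add_sq_of_height {F : Type*} [NormedAddCommGroup F] {a p : F} {ρ τ s n : ℝ}
    (hs : 0 ≤ s) (hτ : 0 ≤ τ) (ha : ‖a‖ = τ ^ 2 * s)
    (hp : ‖p‖ ≤ s * ρ ^ 2 + n * ρ ^ 3) (hτs : τ * s ≤ 1 / 2) (hn : τ * (ρ * n) ≤ 1 / 2)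
    (hρn : 0 ≤ ρ * n) :
    (τ ^ 2 * s) ^ 2 ≤ ρ ^ 2 + ‖a - p‖ ^ 2 := by
  have h1 : (‖a‖ - ‖p‖) ^ 2 ≤ ‖a - p‖ ^ 2 :=
    sq_le_sq.2 (by rw [abs_of_nonneg (norm_nonneg (a - p))]; exact abs_norm_sub_norm_le a p)
  have h2 : 2 * (τ ^ 2 * s) * (s * ρ ^ 2 + n * ρ ^ 3) ≤ ρ ^ 2 := by
    have h0 : 0 ≤ τ * s := mul_nonneg hτ hs
    have h3 : 2 * (τ * s) * (τ * s + τ * (ρ * n)) ≤ 2 * (1 / 2) * (1 / 2 + 1 / 2) := by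
      have := mul_nonneg hτ hρn
      gcongr
    calc 2 * (τ ^ 2 * s) * (s * ρ ^ 2 + n * ρ ^ 3)
        = 2 * (τ * s) * (τ * s + τ * (ρ * n)) * ρ ^ 2 := by ring
      _ ≤ 2 * (1 / 2) * (1 / 2 + 1 / 2) * ρ ^ 2 := by gcongr
      _ = ρ ^ 2 := by ring
  have h4 : 2 * (τ ^ 2 * s) * ‖p‖ ≤ 2 * (τ ^ 2 * s) * (s * ρ ^ 2 + n * ρ ^ 3) := by gcongr
  rw [ha] at h1
  nlinarith [sq_nonneg ‖p‖]

/-- Lower bound for the local convexity defect of the algebraic graph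
`M(S,T) = {(v, S(v,v) + T(v,v,v))} ⊆ ℝ^d ×₂ ℝ^{D-d}`. -/
theorem cdfLoc_lower_bound_algebraic {d m : ℕ}
    (S : EuclideanSpace ℝ (Fin d) →L[ℝ] EuclideanSpace ℝ (Fin d) →L[ℝ]
          EuclideanSpace ℝ (Fin m))
    (T : EuclideanSpace ℝ (Fin d) →L[ℝ] EuclideanSpace ℝ (Fin d) →L[ℝ]
          EuclideanSpace ℝ (Fin d) →L[ℝ] EuclideanSpace ℝ (Fin m))
    (nS nT : ℝ)
    (hnS : nS = sSup ((fun v => ‖S v v‖) '' Metric.closedBall (0 : EuclideanSpace ℝ (Fin d)) 1))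
    (hnT : nT = sSup ((fun v => ‖T v v v‖) '' Metric.closedBall (0 : EuclideanSpace ℝ (Fin d)) 1))
    (X : Set (WithLp 2 (EuclideanSpace ℝ (Fin d) × EuclideanSpace ℝ (Fin m))))
    (hX : X = {x | ∃ v : EuclideanSpace ℝ (Fin d),
      x = (WithLp.equiv 2 (EuclideanSpace ℝ (Fin d) × EuclideanSpace ℝ (Fin m))).symm
            (v, S v v + T v v v)})
    (r₁ r₂ t : ℝ) (hr₁ : 0 < r₁) (hr₁₂ : r₁ ≤ r₂)
    (hr₂T : r₂ ^ 2 * nT ≤ Real.sqrt 13 / 4)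
    (ht : 0 < t) (htS : t * nS ≤ 1 / 2) (htr : t ≤ 2 / Real.sqrt 13 * r₁) :
    (t - 1 / 2 * t ^ 5 * nT ^ 2) ^ 2 * nS ≤ cdfLoc X 0 r₁ r₂ t ∧
      t ^ 2 * nS - t ^ 6 * nS * nT ^ 2 ≤ (t - 1 / 2 * t ^ 5 * nT ^ 2) ^ 2 * nS := by
  have hSc : Continuous fun v => S v v := by fun_prop
  have hTc : Continuous fun v => T v v v := by fun_prop
  have hs : 0 ≤ nS := hnS ▸ Real.sSup_nonneg (by rintro _ ⟨v, -, rfl⟩; exact norm_nonneg _)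
  have hn : 0 ≤ nT := hnT ▸ Real.sSup_nonneg (by rintro _ ⟨v, -, rfl⟩; exact norm_nonneg _)
  have hSle (w) : ‖S w w‖ ≤ nS * ‖w‖ ^ 2 := hnS ▸ norm_le_sSup_unitBall_mul_pow hSc
    (fun c v => by simp [smul_smul, pow_succ]) (by simp) w
  have hTle (w) : ‖T w w w‖ ≤ nT * ‖w‖ ^ 3 := hnT ▸ norm_le_sSup_unitBall_mul_pow hTc
    (fun c v => by simp [smul_smul, pow_succ, mul_assoc]) (by simp) w
  refine ⟨?_, by nlinarith [mul_nonneg hs (sq_nonneg (t ^ 5 * nT ^ 2))]⟩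
  have h13 : 0 < √(13 : ℝ) := by positivity
  have h13sq : √(13 : ℝ) ^ 2 = 13 := Real.sq_sqrt (by norm_num)
  have htr' : √13 * t ≤ 2 * r₁ := by
    calc √13 * t ≤ √13 * (2 / √13 * r₁) := by gcongr
      _ = 2 * r₁ := by field_simp
  have htr₂ : √13 * t ≤ 2 * r₂ := by linarith
  have htr_sq : 13 * t ^ 2 ≤ 4 * r₁ ^ 2 := by
    have := pow_le_pow_left₀ (by positivity) htr' 2
    rw [mul_pow, mul_pow, h13sq] at this
    linarith
  have htrn : t * (r₂ * nT) ≤ 1 / 2 := by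
    refine le_of_mul_le_mul_left ?_ h13
    calc √13 * (t * (r₂ * nT)) = √13 * t * (r₂ * nT) := by ring
      _ ≤ 2 * r₂ * (r₂ * nT) := by
        have : 0 ≤ r₂ * nT := mul_nonneg (by linarith) hn
        gcongr
      _ ≤ √13 * (1 / 2) := by linarith
  have htn : t ^ 4 * nT ^ 2 ≤ 1 / 13 := by
    have h : √13 * (t ^ 2 * nT) ≤ 1 := by
      calc √13 * (t ^ 2 * nT) = √13 * t * (t * nT) := by ring
        _ ≤ 2 * r₂ * (t * nT) := by gcongr
        _ ≤ 1 := by linarith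
    have := pow_le_pow_left₀ (by positivity) h 2
    rw [mul_pow, h13sq] at this
    linarith
  obtain ⟨hτ0, hτt, hchord⟩ := half_chord_bounds ht htn
  set τ := t - 1 / 2 * t ^ 5 * nT ^ 2
  obtain ⟨v, hv, hvS⟩ : ∃ v ∈ Metric.closedBall (0 : EuclideanSpace ℝ (Fin d)) 1,
      ‖S v v‖ = nS := hnS ▸ ((isCompact_closedBall 0 1).image hSc.norm).sSup_mem
        ⟨_, 0, by simp, rfl⟩
  have hv1 : ‖v‖ ≤ 1 := mem_closedBall_zero_iff.1 hv
  have hvT : ‖T v v v‖ ≤ nT := (hTle v).trans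
    (mul_le_of_le_one_right hn (pow_le_one₀ (norm_nonneg _) hv1))
  let graph (w : EuclideanSpace ℝ (Fin d)) :
      WithLp 2 (EuclideanSpace ℝ (Fin d) × EuclideanSpace ℝ (Fin m)) :=
    WithLp.toLp 2 (w, S w w + T w w w)
  have hgraph (w) : graph w ∈ X := hX ▸ ⟨w, rfl⟩
  have hmid : midpoint ℝ (graph (τ • v)) (graph (-(τ • v))) = WithLp.toLp 2 (0, τ ^ 2 • S v v) := by
    rw [midpoint_eq_smul_add, ← WithLp.toLp_add, ← WithLp.toLp_smul]
    congr 1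
    ext1
    · simp
    · simp only [Prod.smul_mk, Prod.mk_add_mk, map_neg, map_smul, neg_apply,
        smul_apply, smul_smul, invOf_eq_inv]
      module
  have hτv : ‖τ • v‖ ≤ τ := by
    rw [norm_smul, Real.norm_of_nonneg hτ0]
    exact mul_le_of_le_one_right hτ0 hv1
  have hball (w) (hw : ‖w‖ ≤ τ) : graph w ∈ Metric.closedBall 0 r₁ := by
    rw [mem_closedBall_zero_iff]
    refine le_of_sq_le_sq ?_ hr₁.le
    rw [WithLp.prod_norm_sq_eq_of_L2]
    refine le_trans ?_ (sq_add_sq_le_of_scale hτ0 hτt hs hn htS htn htr_sq)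
    have h : ‖S w w + T w w w‖ ≤ τ ^ 2 * nS + τ ^ 3 * nT := by
      calc ‖S w w + T w w w‖ ≤ nS * ‖w‖ ^ 2 + nT * ‖w‖ ^ 3 :=
            norm_add_le_of_le (hSle w) (hTle w)
        _ ≤ nS * τ ^ 2 + nT * τ ^ 3 := by gcongr
        _ = _ := by ring
    change ‖w‖ ^ 2 + ‖S w w + T w w w‖ ^ 2 ≤ _
    gcongr
  refine le_cdfLoc_of_pair hr₁₂ ht.le ⟨hgraph (τ • v), hball _ hτv⟩
    ⟨hgraph (-(τ • v)), hball _ (by rwa [norm_neg])⟩ ?_ ?_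
  · rw [hmid, dist_eq_norm]
    refine le_of_sq_le_sq ?_ ht.le
    rw [WithLp.prod_norm_sq_eq_of_L2]
    refine le_trans ?_ hchord
    change ‖τ • v - 0‖ ^ 2 + ‖S (τ • v) (τ • v) + T (τ • v) (τ • v) (τ • v) - τ ^ 2 • S v v‖ ^ 2 ≤ _
    have h : S (τ • v) (τ • v) + T (τ • v) (τ • v) (τ • v) - τ ^ 2 • S v v = τ ^ 3 • T v v v := by
      simp only [map_smul, smul_apply, smul_smul]
      module
    rw [h, norm_smul (τ ^ 3), Real.norm_of_nonneg (by positivity), sub_zero]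
    calc ‖τ • v‖ ^ 2 + (τ ^ 3 * ‖T v v v‖) ^ 2 ≤ τ ^ 2 + (τ ^ 3 * nT) ^ 2 := by gcongr
      _ = _ := by ring
  · rintro z ⟨hz, hzr⟩
    rw [hX] at hz
    obtain ⟨w, rfl⟩ := hz
    rw [mem_closedBall_zero_iff] at hzr
    have hw : ‖w‖ ≤ r₂ := (WithLp.norm_fst_le _ _).trans hzr
    rw [hmid, dist_eq_norm]
    refine le_of_sq_le_sq ?_ (norm_nonneg _)
    rw [WithLp.prod_norm_sq_eq_of_L2]
    change _ ≤ ‖0 - w‖ ^ 2 + ‖τ ^ 2 • S v v - (S w w + T w w w)‖ ^ 2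
    rw [zero_sub, norm_neg]
    refine sq_le_sq_add_sq_of_height hs hτ0 ?_ (norm_add_le_of_le (hSle w) (hTle w)) ?_ ?_
      (mul_nonneg (norm_nonneg _) hn)
    · rw [norm_smul, Real.norm_of_nonneg (by positivity), hvS]
    · exact (mul_le_mul_of_nonneg_right hτt hs).trans htS
    · refine le_trans ?_ htrn
      gcongr
end

section
/- Let M and M̃ be nonempty compact subsets of ℝ^D with Hausdorff distance H(M, M̃) < ε, where 0 < ε < Δ < 1. Suppose there are constants κ ≥ 0 and C ≥ 0 such that |h_M(t) − (κ/2) t²| ≤ C t⁴ for all t ∈ [0, Δ + ε]. Then |κ − 2 h_{M̃}(Δ)/Δ²| ≤ 2C Δ² + (3κ + 30C + 4) ε Δ^{−2}. In particular, if in addition Δ = ε^{1/4}, then |κ − 2 h_{M̃}(Δ)/Δ²| ≤ (3κ + 32C + 4) ε^{1/2}. -/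
theorem rad_le_of_subset_closedBall {E : Type*} [NormedAddCommGroup E] {σ : Set E}
    {r : ℝ} (hr : 0 ≤ r) {c : E} (h : σ ⊆ Metric.closedBall c r) : rad σ ≤ r :=
  csInf_le ⟨0, fun _ hx => hx.1⟩ ⟨hr, c, h⟩

theorem rad_nonneg {E : Type*} [NormedAddCommGroup E] (σ : Set E) : 0 ≤ rad σ :=
  Real.sInf_nonneg fun _ hx => hx.1

theorem scaleHull_subset_convexHull {E : Type*} [NormedAddCommGroup E] [NormedSpace ℝ E]
    (X : Set E) (t : ℝ) : scaleHull X t ⊆ convexHull ℝ X :=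
  Set.iUnion₂_subset fun _ hσ => convexHull_mono hσ.1

theorem cdf_nonneg {E : Type*} [NormedAddCommGroup E] [NormedSpace ℝ E]
    (X : Set E) (t : ℝ) : 0 ≤ cdf X t :=
  Real.sSup_nonneg (Set.forall_mem_image.2 fun _ _ => Metric.infDist_nonneg)

theorem infDist_le_cdf {E : Type*} [NormedAddCommGroup E] [NormedSpace ℝ E]
    {X : Set E} (hX : Bornology.IsBounded X) {t : ℝ} {a : E} (ha : a ∈ scaleHull X t) :
    Metric.infDist a X ≤ cdf X t := by
  refine le_csSup ?_ (Set.mem_image_of_mem _ ha)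
  have hb : Bornology.IsBounded (scaleHull X t) :=
    (isBounded_convexHull.2 hX).subset (scaleHull_subset_convexHull X t)
  exact ((Metric.lipschitz_infDist_pt X).isBounded_image hb).bddAbove

open scoped Pointwise in
/-- The convexity defect function is stable under Hausdorff-small perturbations. -/
theorem cdf_le_cdf_add_of_hausdorffDist_lt {E : Type*} [NormedAddCommGroup E] [NormedSpace ℝ E]
    {X Y : Set E} (hX : Bornology.IsBounded X) (hXne : X.Nonempty)
    (hY : Bornology.IsBounded Y) (hYne : Y.Nonempty)
    {ε : ℝ} (h : Metric.hausdorffDist X Y < ε) (t : ℝ) :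
    cdf X t ≤ cdf Y (t + ε) + 2 * ε := by
  have hε : 0 < ε := Metric.hausdorffDist_nonneg.trans_lt h
  refine Real.sSup_le (Set.forall_mem_image.2 fun a ha => ?_)
    (by linarith [cdf_nonneg Y (t + ε)])
  have hfin : Metric.hausdorffEDist X Y ≠ ⊤ :=
    Metric.hausdorffEDist_ne_top_of_nonempty_of_bounded hXne hYne hX hY
  obtain ⟨δ, hδ, hδε⟩ := exists_between h
  simp only [scaleHull, Set.mem_iUnion] at ha
  obtain ⟨σ, ⟨hσX, hσt⟩, ha⟩ := ha
  let τ : Set E := {y ∈ Y | ∃ x ∈ σ, dist x y < δ}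
  have hτ : rad τ ≤ t + ε := by
    obtain ⟨c, hc⟩ := exists_subset_closedBall_of_rad_lt (r := t + (ε - δ)) (hX.subset hσX)
      (by linarith)
    refine rad_le_of_subset_closedBall (c := c) (by linarith [rad_nonneg σ]) ?_
    rintro y ⟨-, x, hx, hxy⟩
    have h1 := Metric.mem_closedBall.1 (hc hx)
    have h2 := dist_triangle_left y c x
    rw [Metric.mem_closedBall]
    linarith
  have hsub : convexHull ℝ σ ⊆ convexHull ℝ τ + Metric.closedBall (0 : E) δ := by
    refine convexHull_min (fun x hx => ?_)
      ((convex_convexHull ℝ τ).add (convex_closedBall 0 δ))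
    obtain ⟨y, hy, hxy⟩ := Metric.exists_dist_lt_of_hausdorffDist_lt (hσX hx) hδ hfin
    refine Set.mem_add.2 ⟨y, subset_convexHull ℝ τ ⟨hy, x, hx, hxy⟩, x - y, ?_, by abel⟩
    rw [mem_closedBall_zero_iff, ← dist_eq_norm]
    exact hxy.le
  obtain ⟨b, hb, v, hv, rfl⟩ := Set.mem_add.1 (hsub ha)
  have hbY : b ∈ scaleHull Y (t + ε) :=
    Set.mem_iUnion₂.2 ⟨τ, ⟨fun _ hy => hy.1, hτ⟩, hb⟩
  have h1 := infDist_le_cdf hY hbY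
  have h2 := Metric.infDist_le_infDist_add_hausdorffDist (x := b)
    (Metric.hausdorffEDist_comm (s := X) (t := Y) ▸ hfin)
  have h3 := Metric.infDist_le_infDist_add_dist (s := X) (x := b + v) (y := b)
  rw [Metric.hausdorffDist_comm] at h2
  rw [dist_eq_norm, add_sub_cancel_left] at h3
  have h4 := mem_closedBall_zero_iff.1 hv
  linarith

theorem abs_sub_two_mul_div_sq_le {κ C ε Δ y : ℝ} (hε : 0 < ε) (hεΔ : ε < Δ) (hΔ : Δ < 1)
    (hκ : 0 ≤ κ) (hC : 0 ≤ C)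
    (hlo : κ / 2 * (Δ - ε) ^ 2 - C * (Δ - ε) ^ 4 - 2 * ε ≤ y)
    (hhi : y ≤ κ / 2 * (Δ + ε) ^ 2 + C * (Δ + ε) ^ 4 + 2 * ε) :
    |κ - 2 * y / Δ ^ 2| ≤ 2 * C * Δ ^ 2 + (3 * κ + 30 * C + 4) * ε / Δ ^ 2 := by
  have hΔ0 : 0 < Δ := hε.trans hεΔ
  have hsq : 0 < Δ ^ 2 := by positivity
  have key : |κ * Δ ^ 2 - 2 * y| ≤ 2 * C * Δ ^ 4 + (3 * κ + 30 * C + 4) * ε := by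
    have hq : (Δ + ε) ^ 2 ≤ Δ ^ 2 + 3 * ε := by nlinarith
    have hq' : Δ ^ 2 - 3 * ε ≤ (Δ - ε) ^ 2 := by nlinarith
    have hf : (Δ + ε) ^ 4 ≤ Δ ^ 4 + 15 * ε := by
      have h3 : Δ ^ 3 ≤ 1 := pow_le_one₀ hΔ0.le hΔ.le
      have h2 : Δ ^ 2 * ε ≤ 1 := mul_le_one₀ (pow_le_one₀ hΔ0.le hΔ.le) hε.le (by linarith)
      have h1 : Δ * ε ^ 2 ≤ 1 :=
        mul_le_one₀ hΔ.le (by positivity) (pow_le_one₀ hε.le (by linarith))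
      have h0 : ε ^ 3 ≤ 1 := pow_le_one₀ hε.le (by linarith)
      nlinarith [mul_le_mul_of_nonneg_left h3 hε.le, mul_le_mul_of_nonneg_left h2 hε.le,
        mul_le_mul_of_nonneg_left h1 hε.le, mul_le_mul_of_nonneg_left h0 hε.le]
    have hf' : (Δ - ε) ^ 4 ≤ Δ ^ 4 + 15 * ε :=
      (pow_le_pow_left₀ (by linarith) (by linarith) 4).trans hf
    have e1 := mul_le_mul_of_nonneg_left hq hκ
    have e2 := mul_le_mul_of_nonneg_left hq' hκ
    have e3 := mul_le_mul_of_nonneg_left hf hC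
    have e4 := mul_le_mul_of_nonneg_left hf' hC
    rw [abs_le]
    constructor <;> linarith
  have e1 : κ - 2 * y / Δ ^ 2 = (κ * Δ ^ 2 - 2 * y) / Δ ^ 2 := by field_simp
  have e2 : 2 * C * Δ ^ 2 + (3 * κ + 30 * C + 4) * ε / Δ ^ 2
      = (2 * C * Δ ^ 4 + (3 * κ + 30 * C + 4) * ε) / Δ ^ 2 := by field_simp
  rw [e1, e2, abs_div, abs_of_pos hsq]
  gcongr

/-- approximation of the pointwise second derivative of the convexity defect
function from a Hausdorff-close set, `C^k` case with `k ≥ 4` (fourth-order Taylor bound). -/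
theorem local_reach_approx_order_four {D : ℕ}
    (M Mt : Set (EuclideanSpace ℝ (Fin D)))
    (hM : IsCompact M) (hMne : M.Nonempty) (hMt : IsCompact Mt) (hMtne : Mt.Nonempty)
    (ε Δ : ℝ) (hε : 0 < ε) (hεΔ : ε < Δ) (hΔ : Δ < 1)
    (hH : Metric.hausdorffDist M Mt < ε)
    (κ C : ℝ) (hκ : 0 ≤ κ) (hC : 0 ≤ C)
    (hTaylor : ∀ t ∈ Set.Icc (0 : ℝ) (Δ + ε), |cdf M t - κ / 2 * t ^ 2| ≤ C * t ^ 4) :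
    |κ - 2 * cdf Mt Δ / Δ ^ 2| ≤ 2 * C * Δ ^ 2 + (3 * κ + 30 * C + 4) * ε / Δ ^ 2 ∧
      (Δ = ε ^ ((1 : ℝ) / 4) →
        |κ - 2 * cdf Mt Δ / Δ ^ 2| ≤ (3 * κ + 32 * C + 4) * ε ^ ((1 : ℝ) / 2)) := by
  have hlo := cdf_le_cdf_add_of_hausdorffDist_lt hM.isBounded hMne hMt.isBounded hMtne hH (Δ - ε)
  have hhi := cdf_le_cdf_add_of_hausdorffDist_lt hMt.isBounded hMtne hM.isBounded hMne
    (Metric.hausdorffDist_comm (s := M) (t := Mt) ▸ hH) Δ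
  rw [sub_add_cancel] at hlo
  have t1 := abs_le.1 (hTaylor (Δ - ε) ⟨by linarith, by linarith⟩)
  have t2 := abs_le.1 (hTaylor (Δ + ε) ⟨by linarith, le_rfl⟩)
  have main := abs_sub_two_mul_div_sq_le (y := cdf Mt Δ) hε hεΔ hΔ hκ hC
    (by linarith [t1.1]) (by linarith [t2.2])
  refine ⟨main, fun hΔε => main.trans (le_of_eq ?_)⟩
  have hsq : Δ ^ 2 = ε ^ ((1 : ℝ) / 2) := by
    rw [hΔε, ← Real.rpow_mul_natCast hε.le]
    norm_num
  have hdiv : ε / Δ ^ 2 = ε ^ ((1 : ℝ) / 2) := by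
    rw [hsq, ← Real.rpow_one_sub' hε.le (by norm_num)]
    norm_num
  rw [mul_div_assoc, hdiv, hsq]
  ring
end
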